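/- arXiv:1605.03516 — 4 statements merged into one kernel-verified Lean document; each statement's English description precedes it below -/
import Mathlib

section
/- Let A and B be n×n positive definite complex matrices and t ∈ [0,1]. Then the eigenvalues of A^{1/2}(A♯_t B)A^{1/2} are log-majorized by those of A^{1−t/2} B^t A^{1−t/2}: for every k with 1 ≤ k ≤ n, the product of the k largest eigenvalues of A^{1/2}(A♯_t B)A^{1/2} is at most the product of the k largest eigenvalues of A^{1−t/2} B^t A^{1−t/2}, with equality when k = n. -/
open Matrix ComplexOrder

/-- Real power of a Hermitian matrix via the functional calculus (spectral decomposition). -/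
noncomputable def mpow {n : ℕ} (A : Matrix (Fin n) (Fin n) ℂ) (r : ℝ) :
    Matrix (Fin n) (Fin n) ℂ :=
  if hA : A.IsHermitian then
    (hA.eigenvectorUnitary : Matrix (Fin n) (Fin n) ℂ) *
      Matrix.diagonal (fun i => ((hA.eigenvalues i ^ r : ℝ) : ℂ)) *
      (star hA.eigenvectorUnitary : Matrix (Fin n) (Fin n) ℂ)
  else 0

/-- The t-geometric mean `A ♯ₜ B = A^{1/2} (A^{-1/2} B A^{-1/2})^t A^{1/2}`. -/
noncomputable def geomMean {n : ℕ} (A B : Matrix (Fin n) (Fin n) ℂ) (t : ℝ) :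
    Matrix (Fin n) (Fin n) ℂ :=
  mpow A (1/2) * mpow (mpow A (-(1/2)) * B * mpow A (-(1/2))) t * mpow A (1/2)

/-- Eigenvalues of a Hermitian matrix in decreasing order. -/
noncomputable def eigsDesc {n : ℕ} (M : Matrix (Fin n) (Fin n) ℂ) : Fin n → ℝ :=
  if hM : M.IsHermitian then fun i => hM.eigenvalues (Tuple.sort hM.eigenvalues (Fin.rev i))
  else 0

section CStarAlgebra

namespace CFC

theorem continuousOn_nnreal_rpow_const_spectrum {𝒜 : Type*} [CStarAlgebra 𝒜] {a : 𝒜}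
    (ha : IsUnit a) (r : ℝ) :
    ContinuousOn (fun x : NNReal => x ^ r) (spectrum NNReal a) := fun _ hx =>
  (NNReal.continuousAt_rpow_const (.inl fun h =>
    spectrum.zero_notMem NNReal ha (h ▸ hx))).continuousWithinAt

variable {𝒜 : Type*} [CStarAlgebra 𝒜] [PartialOrder 𝒜] [StarOrderedRing 𝒜]

theorem rpow_unitary_conj (w : unitary 𝒜) {a : 𝒜} (ha : IsStrictlyPositive a) (r : ℝ) :
    ((w : 𝒜) * a * star (w : 𝒜)) ^ r = (w : 𝒜) * a ^ r * star (w : 𝒜) := by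
  have hcont : Continuous (Unitary.conjStarAlgAut ℝ 𝒜 w) := by
    have : (Unitary.conjStarAlgAut ℝ 𝒜 w : 𝒜 → 𝒜) = fun x => (w : 𝒜) * x * star (w : 𝒜) :=
      funext fun x => Unitary.conjStarAlgAut_apply _ _
    rw [this]
    fun_prop
  have h := StarAlgHomClass.map_cfc (R := NNReal) (S := ℝ) (Unitary.conjStarAlgAut ℝ 𝒜 w)
    (fun x : NNReal => x ^ r) a (continuousOn_nnreal_rpow_const_spectrum ha.isUnit r) hcont
    ha.nonneg (by
      rw [Unitary.conjStarAlgAut_apply]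
      exact star_right_conjugate_nonneg ha.nonneg _)
  simpa only [Unitary.conjStarAlgAut_apply, CFC.rpow_def] using h.symm

theorem smul_rpow {a : 𝒜} (ha : IsStrictlyPositive a) (s : NNReal) (hs : s ≠ 0) (r : ℝ) :
    (s • a) ^ r = s ^ r • a ^ r := by
  have hc := continuousOn_nnreal_rpow_const_spectrum ha.isUnit r
  rw [CFC.rpow_def, CFC.rpow_def, ← cfc_comp_smul s (fun x : NNReal => x ^ r) a
    (by
      rintro _ ⟨x, hx, rfl⟩
      refine (NNReal.continuousAt_rpow_const (.inl ?_)).continuousWithinAt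
      exact smul_ne_zero hs fun h => spectrum.zero_notMem NNReal ha.isUnit (h ▸ hx)) ha.nonneg]
  rw [← cfc_smul (s ^ r) (fun x : NNReal => x ^ r) a hc]
  simp only [smul_eq_mul, NNReal.mul_rpow]

theorem rpow_neg_half_mul_mul_rpow_neg_half_isStrictlyPositive {a b : 𝒜}
    (ha : IsStrictlyPositive a) (hb : IsStrictlyPositive b) :
    IsStrictlyPositive (a ^ (-(1 / 2) : ℝ) * b * a ^ (-(1 / 2) : ℝ)) := by
  have hp : IsStrictlyPositive (a ^ (-(1 / 2) : ℝ)) := .rpow a _ ha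
  refine ((hp.isUnit.mul hb.isUnit).mul hp.isUnit).isStrictlyPositive ?_
  exact conjugate_nonneg_of_nonneg hb.nonneg hp.nonneg

/-- The weighted geometric mean satisfies `a ♯ₜ b = b ♯₁₋ₜ a`. -/
theorem geomMean_comm {a b : 𝒜} (ha : IsStrictlyPositive a) (hb : IsStrictlyPositive b) (t : ℝ) :
    a ^ (1 / 2 : ℝ) * (a ^ (-(1 / 2) : ℝ) * b * a ^ (-(1 / 2) : ℝ)) ^ t * a ^ (1 / 2 : ℝ) =
      b ^ (1 / 2 : ℝ) * (b ^ (-(1 / 2) : ℝ) * a * b ^ (-(1 / 2) : ℝ)) ^ (1 - t) *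
        b ^ (1 / 2 : ℝ) := by
  set m := a ^ (-(1 / 2) : ℝ) * b * a ^ (-(1 / 2) : ℝ) with hm
  have hmp : IsStrictlyPositive m :=
    rpow_neg_half_mul_mul_rpow_neg_half_isStrictlyPositive ha hb
  have sa : ∀ (x : 𝒜) (r : ℝ), star (x ^ r) = x ^ r := fun x r =>
    (IsSelfAdjoint.of_nonneg rpow_nonneg).star_eq
  have pow_mul : ∀ {x : 𝒜}, IsStrictlyPositive x → ∀ r s : ℝ, x ^ r * x ^ s = x ^ (r + s) :=
    fun hx r s => (rpow_add hx.isUnit).symm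
  have hm_half := rpow_mul_rpow_neg (1 / 2) hmp
  have hm_half' := rpow_neg_mul_rpow (1 / 2) hmp
  have ha_half := rpow_mul_rpow_neg (1 / 2) ha
  have ha_half' := rpow_neg_mul_rpow (1 / 2) ha
  have hbb : b ^ (1 / 2 : ℝ) * b ^ (1 / 2 : ℝ) = b := by
    rw [pow_mul hb, add_halves, rpow_one b hb.nonneg]
  have haa : a ^ (-(1 / 2) : ℝ) * a * a ^ (-(1 / 2) : ℝ) = 1 := by
    nth_rw 2 [← rpow_one a ha.nonneg]
    rw [pow_mul ha, pow_mul ha]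
    norm_num [rpow_zero a ha.nonneg]
  set w := b ^ (1 / 2 : ℝ) * a ^ (-(1 / 2) : ℝ) * m ^ (-(1 / 2) : ℝ) with hw
  have hw_star : star w = m ^ (-(1 / 2) : ℝ) * a ^ (-(1 / 2) : ℝ) * b ^ (1 / 2 : ℝ) := by
    simp only [hw, star_mul, sa, mul_assoc]
  have hw1 : star w * w = 1 := by
    calc star w * w = m ^ (-(1 / 2) : ℝ) * (a ^ (-(1 / 2) : ℝ) *
          (b ^ (1 / 2 : ℝ) * b ^ (1 / 2 : ℝ)) * a ^ (-(1 / 2) : ℝ)) * m ^ (-(1 / 2) : ℝ) := by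
          rw [hw_star, hw]; simp only [mul_assoc]
      _ = m ^ (-(1 / 2) : ℝ) * m ^ (1 : ℝ) * m ^ (-(1 / 2) : ℝ) := by
          rw [hbb, ← hm, rpow_one m hmp.nonneg]
      _ = 1 := by
          rw [pow_mul hmp, pow_mul hmp]
          norm_num [rpow_zero m hmp.nonneg]
  have hwu : IsUnit w :=
    (((IsStrictlyPositive.rpow b _ hb).isUnit.mul (IsStrictlyPositive.rpow a _ ha).isUnit).mul
      (IsStrictlyPositive.rpow m _ hmp).isUnit)
  have hw2 : w * star w = 1 := by
    exact hwu.mul_right_cancel (by rw [mul_assoc, hw1, mul_one, one_mul])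
  have hb_eq : b ^ (1 / 2 : ℝ) = w * m ^ (1 / 2 : ℝ) * a ^ (1 / 2 : ℝ) := by
    rw [hw, mul_assoc _ (m ^ (-(1 / 2) : ℝ)), hm_half', mul_one, mul_assoc, ha_half', mul_one]
  have hb_eq' : b ^ (1 / 2 : ℝ) = a ^ (1 / 2 : ℝ) * m ^ (1 / 2 : ℝ) * star w := by
    have := congrArg star hb_eq
    simpa only [star_mul, sa, mul_assoc] using this
  have hb_inv : b ^ (-(1 / 2) : ℝ) = w * m ^ (-(1 / 2) : ℝ) * a ^ (-(1 / 2) : ℝ) := by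
    refine left_inv_eq_right_inv (rpow_neg_mul_rpow (1 / 2) hb) ?_
    rw [hb_eq']
    calc _ = a ^ (1 / 2 : ℝ) * (m ^ (1 / 2 : ℝ) * (star w * w) * m ^ (-(1 / 2) : ℝ)) *
          a ^ (-(1 / 2) : ℝ) := by simp only [mul_assoc]
      _ = 1 := by rw [hw1, mul_one, hm_half, mul_one, ha_half]
  have hb_inv' : b ^ (-(1 / 2) : ℝ) = a ^ (-(1 / 2) : ℝ) * m ^ (-(1 / 2) : ℝ) * star w := by
    have := congrArg star hb_inv
    simpa only [star_mul, sa, mul_assoc] using this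
  have hconj : b ^ (-(1 / 2) : ℝ) * a * b ^ (-(1 / 2) : ℝ) = w * m ^ (-1 : ℝ) * star w := by
    calc _ = w * (m ^ (-(1 / 2) : ℝ) * (a ^ (-(1 / 2) : ℝ) * a * a ^ (-(1 / 2) : ℝ)) *
          m ^ (-(1 / 2) : ℝ)) * star w := by
          nth_rw 1 [hb_inv]; rw [hb_inv']; simp only [mul_assoc]
      _ = _ := by rw [haa, mul_one, pow_mul hmp]; norm_num
  have hpow : (w * m ^ (-1 : ℝ) * star w) ^ (1 - t) = w * m ^ (t - 1) * star w := by
    rw [rpow_unitary_conj ⟨w, Unitary.mem_iff.mpr ⟨hw1, hw2⟩⟩ (.rpow m _ hmp),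
      rpow_rpow m _ _ (by norm_num) hmp]
    congr 3; ring
  rw [hconj, hpow]
  symm
  calc _ = a ^ (1 / 2 : ℝ) * (m ^ (1 / 2 : ℝ) * (star w * w) * m ^ (t - 1) * (star w * w) *
        m ^ (1 / 2 : ℝ)) * a ^ (1 / 2 : ℝ) := by
        nth_rw 1 [hb_eq']; rw [hb_eq]; simp only [mul_assoc]
    _ = _ := by
        rw [hw1, mul_one, mul_one, pow_mul hmp, pow_mul hmp]
        congr 3; ring

/-- If `a ^ (1 - t / 2) * b ^ t * a ^ (1 - t / 2) ≤ 1` then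
`a ^ (1 / 2) * (a ♯ₜ b) * a ^ (1 / 2) ≤ 1`.
By Löwner–Heinz the assumption gives `b ^ (t / (2 - t)) ≤ a⁻¹`, and the claim then follows by
writing `a ♯ₜ b = b ♯₁₋ₜ a`. -/
theorem conj_geomMean_le_one {a b : 𝒜} (ha : IsStrictlyPositive a) (hb : IsStrictlyPositive b)
    {t : ℝ} (ht : t ∈ Set.Icc (0 : ℝ) 1)
    (h : a ^ (1 - t / 2) * b ^ t * a ^ (1 - t / 2) ≤ 1) :
    a ^ (1 / 2 : ℝ) *
      (a ^ (1 / 2 : ℝ) * (a ^ (-(1 / 2) : ℝ) * b * a ^ (-(1 / 2) : ℝ)) ^ t * a ^ (1 / 2 : ℝ)) *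
        a ^ (1 / 2 : ℝ) ≤ 1 := by
  obtain ⟨ht0, ht1⟩ := ht
  have pow_mul : ∀ {x : 𝒜}, IsStrictlyPositive x → ∀ r s : ℝ, x ^ r * x ^ s = x ^ (r + s) :=
    fun hx r s => (rpow_add hx.isUnit).symm
  have h2t : 0 < 2 - t := by linarith
  rcases ht0.eq_or_lt with rfl | ht0
  · rw [rpow_zero b hb.nonneg] at h
    rw [rpow_zero _ (rpow_neg_half_mul_mul_rpow_neg_half_isStrictlyPositive ha hb).nonneg]
    refine le_trans (le_of_eq ?_) h
    rw [mul_one, mul_one, pow_mul ha, pow_mul ha, pow_mul ha, pow_mul ha]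
    norm_num
  have h1 : b ^ t ≤ a ^ (-(2 - t)) := by
    have := conjugate_le_conjugate_of_nonneg h (c := a ^ (-(1 - t / 2))) rpow_nonneg
    have e : a ^ (-(1 - t / 2)) * (a ^ (1 - t / 2) * b ^ t * a ^ (1 - t / 2)) *
        a ^ (-(1 - t / 2)) = b ^ t := by
      simp only [mul_assoc, rpow_mul_rpow_neg _ ha, mul_one]
      rw [← mul_assoc, rpow_neg_mul_rpow _ ha, one_mul]
    rw [e, mul_one, pow_mul ha] at this
    convert this using 2
    ring
  have h2 : b ^ (t / (2 - t)) ≤ a ^ (-1 : ℝ) := by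
    have := rpow_le_rpow (p := (2 - t)⁻¹) ⟨by positivity, inv_le_one_of_one_le₀ (by linarith)⟩ h1
    rw [rpow_rpow b _ _ ht0.ne' hb, rpow_rpow a _ _ (by linarith) ha] at this
    convert this using 2 <;> field_simp
  have h3 : a ≤ b ^ (-(t / (2 - t))) := by
    have := CStarAlgebra.rpow_neg_one_le_rpow_neg_one h2 (.rpow b _ hb)
    rw [rpow_rpow a _ _ (by norm_num) ha, rpow_rpow b _ _ (by positivity) hb] at this
    simpa [rpow_one a ha.nonneg] using this
  have h4 : b ^ (-(1 / 2) : ℝ) * a * b ^ (-(1 / 2) : ℝ) ≤ b ^ (-(2 / (2 - t))) := by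
    have := conjugate_le_conjugate_of_nonneg h3 (c := b ^ (-(1 / 2) : ℝ)) rpow_nonneg
    rw [pow_mul hb, pow_mul hb] at this
    convert this using 2
    field_simp; ring
  have h5 := rpow_le_rpow (p := 1 - t) ⟨by linarith, by linarith⟩ h4
  rw [rpow_rpow b _ _ (by simp [h2t.ne']) hb] at h5
  have h6 := conjugate_le_conjugate_of_nonneg h5 (c := b ^ (1 / 2 : ℝ)) rpow_nonneg
  rw [← geomMean_comm ha hb, pow_mul hb, pow_mul hb] at h6
  have h7 : 1 / 2 + -(2 / (2 - t)) * (1 - t) + 1 / 2 = t / (2 - t) := by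
    field_simp; ring
  rw [h7] at h6
  refine (conjugate_le_conjugate_of_nonneg (h6.trans h2) rpow_nonneg).trans (le_of_eq ?_)
  rw [pow_mul ha, pow_mul ha]
  norm_num [rpow_zero a ha.nonneg]

theorem conj_geomMean_le_smul_one {a b : 𝒜} (ha : IsStrictlyPositive a)
    (hb : IsStrictlyPositive b) {t : ℝ} (ht : t ∈ Set.Icc (0 : ℝ) 1) {c : NNReal} (hc : c ≠ 0)
    (h : a ^ (1 - t / 2) * b ^ t * a ^ (1 - t / 2) ≤ c • (1 : 𝒜)) :
    a ^ (1 / 2 : ℝ) *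
      (a ^ (1 / 2 : ℝ) * (a ^ (-(1 / 2) : ℝ) * b * a ^ (-(1 / 2) : ℝ)) ^ t * a ^ (1 / 2 : ℝ)) *
        a ^ (1 / 2 : ℝ) ≤ c • (1 : 𝒜) := by
  have h2t : 2 - t ≠ 0 := by linarith [ht.2]
  obtain ⟨s, hs, hsc⟩ : ∃ s : NNReal, s ≠ 0 ∧ s ^ (2 - t) = c⁻¹ :=
    ⟨c⁻¹ ^ (2 - t)⁻¹, by simp [NNReal.rpow_eq_zero_iff, hc],
      NNReal.rpow_inv_rpow h2t _⟩
  have hsa : IsStrictlyPositive (s • a) :=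
    .smul (pos_iff_ne_zero.mpr hs) ha
  have key := conj_geomMean_le_one hsa hb ht
  have pw : ∀ r q : ℝ, s ^ r * s ^ q = s ^ (r + q) := fun r q => (NNReal.rpow_add hs r q).symm
  have e1 : (1 - t / 2) + (1 - t / 2) = 2 - t := by ring
  simp only [smul_rpow ha s hs, smul_mul_assoc, mul_smul_comm, smul_smul, pw, e1, hsc] at key
  rw [smul_rpow (rpow_neg_half_mul_mul_rpow_neg_half_isStrictlyPositive ha hb) _
    (by simp [NNReal.rpow_eq_zero_iff, hs])] at key
  simp only [smul_mul_assoc, mul_smul_comm, smul_smul, pw, ← NNReal.rpow_mul] at key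
  have e2 : 1 / 2 + (1 / 2 + 1 / 2 + 1 / 2) + (-(1 / 2) + -(1 / 2)) * t = 2 - t := by ring
  have hc_pos : 0 < c := pos_iff_ne_zero.mpr hc
  simp only [e2, hsc, inv_smul_le_iff_of_pos hc_pos] at key
  exact key h

end CFC

end CStarAlgebra

section Compound

open Set

variable {R : Type*} [CommRing R] {n : ℕ}

namespace Matrix

/-- The `k`-th compound matrix: the matrix of `k × k` minors. -/
noncomputable def compound (k : ℕ) (M : Matrix (Fin n) (Fin n) R) :
    Matrix (powersetCard (Fin n) k) (powersetCard (Fin n) k) R :=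
  of fun I J => (M.submatrix (powersetCard.ofFinEmbEquiv.symm I)
    (powersetCard.ofFinEmbEquiv.symm J)).det

theorem compound_eq_toMatrix (k : ℕ) (M : Matrix (Fin n) (Fin n) R) :
    compound k M = LinearMap.toMatrix ((Pi.basisFun R (Fin n)).exteriorPower k)
      ((Pi.basisFun R (Fin n)).exteriorPower k) (exteriorPower.map k (toLin' M)) := by
  ext I J
  rw [compound, of_apply, LinearMap.toMatrix_apply, exteriorPower.basis_apply,
    exteriorPower.basis_repr_apply,
    exteriorPower.ιMulti_family, exteriorPower.map_apply_ιMulti,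
    exteriorPower.ιMultiDual_apply_ιMulti, ← det_transpose]
  congr 1
  ext i j
  simp

theorem compound_mul (k : ℕ) (M N : Matrix (Fin n) (Fin n) R) :
    compound k (M * N) = compound k M * compound k N := by
  simp only [compound_eq_toMatrix, toLin'_mul]
  rw [exteriorPower.map_comp, LinearMap.toMatrix_comp _ ((Pi.basisFun R (Fin n)).exteriorPower k)]

theorem compound_conjTranspose [StarRing R] (k : ℕ) (M : Matrix (Fin n) (Fin n) R) :
    compound k Mᴴ = (compound k M)ᴴ := by
  ext I J
  simp [compound, ← det_conjTranspose]

theorem compound_diagonal (k : ℕ) (d : Fin n → R) :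
    compound k (diagonal d) = diagonal fun I => ∏ i ∈ I.1, d i := by
  ext I J
  rcases eq_or_ne I J with rfl | h
  · rw [diagonal_apply_eq]
    have h1 : ((diagonal d).submatrix (powersetCard.ofFinEmbEquiv.symm I)
        (powersetCard.ofFinEmbEquiv.symm I)) =
          diagonal (d ∘ powersetCard.ofFinEmbEquiv.symm I) :=
      submatrix_diagonal _ _ (powersetCard.ofFinEmbEquiv.symm I).injective
    rw [compound, of_apply, h1, det_diagonal, powersetCard.ofFinEmbEquiv_symm_apply]
    conv_rhs => rw [← Finset.map_orderEmbOfFin_univ I.1 I.2, Finset.prod_map]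
    rfl
  · rw [diagonal_apply_ne _ h]
    obtain ⟨i, hI, hJ⟩ := (powersetCard.exists_mem_notMem_iff_ne I J).mp h
    obtain ⟨l, rfl⟩ := (powersetCard.mem_range_ofFinEmbEquiv_symm_iff_mem I i).mpr hI
    refine det_eq_zero_of_row_eq_zero l fun j => ?_
    rw [submatrix_apply, diagonal_apply_ne]
    intro h'
    exact hJ (h' ▸ (powersetCard.mem_range_ofFinEmbEquiv_symm_iff_mem J _).mp ⟨j, rfl⟩)

theorem compound_one (k : ℕ) :
    compound k (1 : Matrix (Fin n) (Fin n) R) = 1 := by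
  rw [← diagonal_one, compound_diagonal]
  simp

end Matrix

end Compound

section LogMajorization

open Set
open scoped Matrix.Norms.L2Operator MatrixOrder

namespace Matrix

theorem diagonal_rpow {ι : Type*} [Fintype ι] [DecidableEq ι] {d : ι → ℝ} (hd : ∀ i, 0 < d i)
    (r : ℝ) :
    (diagonal fun i => (d i : ℂ)) ^ r = diagonal fun i => ((d i ^ r : ℝ) : ℂ) := by
  set D : Matrix ι ι ℂ := diagonal fun i => (d i : ℂ) with hD
  have hD0 : 0 ≤ D := by
    rw [nonneg_iff_posSemidef, posSemidef_diagonal_iff]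
    exact fun i => by exact_mod_cast (hd i).le
  have hspec : spectrum ℝ D ⊆ Set.range d := fun x hx => by
    have := (spectrum.algebraMap_mem_iff ℂ).mpr hx
    rw [spectrum_diagonal] at this
    obtain ⟨i, hi⟩ := this
    exact ⟨i, by simpa using hi⟩
  let q : Polynomial ℝ := Lagrange.interpolate (Finset.univ.image d) id fun x => x ^ r
  have hq : ∀ i, q.eval (d i) = d i ^ r := fun i =>
    Lagrange.eval_interpolate_at_node (v := id) _ Function.injective_id.injOn
      (Finset.mem_image_of_mem d (Finset.mem_univ i))
  have hDd : D = diagonalAlgHom ℝ (fun i => (d i : ℂ)) := rfl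
  rw [CFC.rpow_eq_cfc_real hD0, cfc_congr (g := q.eval), cfc_polynomial q D, hDd,
    Polynomial.aeval_algHom_apply]
  · change diagonal _ = _
    congr 1
    ext i
    have := Polynomial.aeval_algHom_apply (Pi.evalAlgHom ℝ (fun _ : ι => ℂ) i)
      (fun i => (d i : ℂ)) q
    rw [Pi.evalAlgHom_apply, Pi.evalAlgHom_apply] at this
    rw [← this, ← hq, ← Complex.coe_algebraMap, Polynomial.aeval_algebraMap_apply,
      Polynomial.coe_aeval_eq_eval]
  · intro x hx
    obtain ⟨i, rfl⟩ := hspec hx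
    exact (hq i).symm

theorem PosDef.exists_unitary_conj {n : ℕ} {M : Matrix (Fin n) (Fin n) ℂ} (hM : M.PosDef) :
    ∃ V : unitaryGroup (Fin n) ℂ,
      M = V * (diagonal fun i => (eigsDesc M i : ℂ)) * star (V : Matrix (Fin n) (Fin n) ℂ) := by
  have hH := hM.isHermitian
  set U := (hH.eigenvectorUnitary : Matrix (Fin n) (Fin n) ℂ) with hU
  let σ : Fin n ≃ Fin n := Fin.revPerm.trans (Tuple.sort hH.eigenvalues)
  have he : eigsDesc M = hH.eigenvalues ∘ σ := by
    rw [eigsDesc, dif_pos hH]; rfl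
  refine ⟨⟨U.submatrix id σ, mem_unitaryGroup_iff.mpr ?_⟩, ?_⟩
  · rw [star_eq_conjTranspose, conjTranspose_submatrix, submatrix_mul_equiv, submatrix_id_id]
    exact mem_unitaryGroup_iff.mp hH.eigenvectorUnitary.2
  · have hd : (diagonal fun i => (eigsDesc M i : ℂ)) =
        (diagonal fun i => (hH.eigenvalues i : ℂ)).submatrix σ σ := by
      rw [submatrix_diagonal_equiv, he]; rfl
    simp only [hd, star_eq_conjTranspose, conjTranspose_submatrix, submatrix_mul_equiv,
      submatrix_id_id]
    exact hH.spectral_theorem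

theorem PosDef.eigsDesc_pos {n : ℕ} {M : Matrix (Fin n) (Fin n) ℂ} (hM : M.PosDef) (i : Fin n) :
    0 < eigsDesc M i := by
  rw [eigsDesc, dif_pos hM.isHermitian]
  exact hM.eigenvalues_pos _

theorem eigsDesc_antitone {n : ℕ} (M : Matrix (Fin n) (Fin n) ℂ) : Antitone (eigsDesc M) := by
  unfold eigsDesc
  split_ifs with hM
  · exact fun i j hij => Tuple.monotone_sort hM.eigenvalues (Fin.rev_le_rev.mpr hij)
  · exact antitone_const

theorem PosDef.det_eq_prod_eigsDesc {n : ℕ} {M : Matrix (Fin n) (Fin n) ℂ} (hM : M.PosDef) :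
    M.det = ((∏ i, eigsDesc M i : ℝ) : ℂ) := by
  obtain ⟨V, hV⟩ := hM.exists_unitary_conj
  conv_lhs => rw [hV]
  rw [det_mul_right_comm, mem_unitaryGroup_iff.mp V.2, one_mul, det_diagonal]
  push_cast; rfl

theorem isStrictlyPositive_unitary_conj_diagonal {ι : Type*} [Fintype ι] [DecidableEq ι]
    (V : unitaryGroup ι ℂ) {d : ι → ℝ} (hd : ∀ i, 0 < d i) :
    IsStrictlyPositive
      ((V : Matrix ι ι ℂ) * (diagonal fun i => (d i : ℂ)) * star (V : Matrix ι ι ℂ)) := by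
  have hV : IsUnit (V : Matrix ι ι ℂ) := (Unitary.toUnits V).isUnit
  rw [hV.isStrictlyPositive_star_right_conjugate_iff, isStrictlyPositive_iff_posDef,
    posDef_diagonal_iff]
  exact fun i => by exact_mod_cast hd i

theorem unitary_conj_diagonal_rpow {ι : Type*} [Fintype ι] [DecidableEq ι]
    (V : unitaryGroup ι ℂ) {d : ι → ℝ} (hd : ∀ i, 0 < d i) (r : ℝ) :
    ((V : Matrix ι ι ℂ) * (diagonal fun i => (d i : ℂ)) * star (V : Matrix ι ι ℂ)) ^ r =
      (V : Matrix ι ι ℂ) * (diagonal fun i => ((d i ^ r : ℝ) : ℂ)) * star (V : Matrix ι ι ℂ) := by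
  rw [CFC.rpow_unitary_conj V, diagonal_rpow hd]
  simpa using isStrictlyPositive_unitary_conj_diagonal 1 hd

theorem PosDef.mpow_eq_rpow {n : ℕ} {M : Matrix (Fin n) (Fin n) ℂ} (hM : M.PosDef) (r : ℝ) :
    mpow M r = M ^ r := by
  rw [mpow, dif_pos hM.isHermitian]
  conv_rhs => rw [hM.isHermitian.spectral_theorem]
  exact (unitary_conj_diagonal_rpow _ hM.eigenvalues_pos r).symm

/-- The compound of a unitary matrix is unitary. -/
noncomputable def compoundUnitary {n : ℕ} (k : ℕ) (V : unitaryGroup (Fin n) ℂ) :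
    unitaryGroup (powersetCard (Fin n) k) ℂ :=
  ⟨compound k (V : Matrix (Fin n) (Fin n) ℂ), mem_unitaryGroup_iff.mpr (by
    rw [star_eq_conjTranspose, ← compound_conjTranspose, ← compound_mul, ← star_eq_conjTranspose,
      mem_unitaryGroup_iff.mp V.2, compound_one])⟩

theorem compound_unitary_conj_diagonal {n : ℕ} (k : ℕ) (V : unitaryGroup (Fin n) ℂ)
    (d : Fin n → ℝ) :
    compound k ((V : Matrix (Fin n) (Fin n) ℂ) * (diagonal fun i => (d i : ℂ)) *
        star (V : Matrix (Fin n) (Fin n) ℂ)) =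
      (compoundUnitary k V : Matrix _ _ ℂ) *
        (diagonal fun I => ((∏ i ∈ I.1, d i : ℝ) : ℂ)) *
          star (compoundUnitary k V : Matrix _ _ ℂ) := by
  rw [compound_mul, compound_mul, compound_diagonal, star_eq_conjTranspose,
    compound_conjTranspose]
  simp only [compoundUnitary, star_eq_conjTranspose, Complex.ofReal_prod]

theorem PosDef.isStrictlyPositive_compound {n : ℕ} {M : Matrix (Fin n) (Fin n) ℂ}
    (hM : M.PosDef) (k : ℕ) : IsStrictlyPositive (compound k M) := by
  obtain ⟨V, hV⟩ := hM.exists_unitary_conj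
  rw [hV, compound_unitary_conj_diagonal]
  exact isStrictlyPositive_unitary_conj_diagonal _
    fun I => Finset.prod_pos fun i _ => hM.eigsDesc_pos i

theorem PosDef.compound_rpow {n : ℕ} {M : Matrix (Fin n) (Fin n) ℂ} (hM : M.PosDef) (k : ℕ)
    (r : ℝ) : compound k (M ^ r) = compound k M ^ r := by
  obtain ⟨V, hV⟩ := hM.exists_unitary_conj
  rw [hV, compound_unitary_conj_diagonal, unitary_conj_diagonal_rpow _ hM.eigsDesc_pos,
    compound_unitary_conj_diagonal, unitary_conj_diagonal_rpow]
  · simp only [Real.finsetProd_rpow _ _ fun i _ => (hM.eigsDesc_pos i).le]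
  · exact fun I => Finset.prod_pos fun i _ => hM.eigsDesc_pos i

/-- The largest eigenvalue of a compound matrix is bounded by `c` exactly when all products of
`k` eigenvalues are. -/
theorem PosDef.compound_le_smul_one_iff {n : ℕ} {M : Matrix (Fin n) (Fin n) ℂ} (hM : M.PosDef)
    (k : ℕ) (c : NNReal) :
    compound k M ≤ c • (1 : Matrix (powersetCard (Fin n) k) (powersetCard (Fin n) k) ℂ) ↔
      ∀ I : powersetCard (Fin n) k, ∏ i ∈ I.1, eigsDesc M i ≤ c := by
  obtain ⟨V, hV⟩ := hM.exists_unitary_conj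
  let W := compoundUnitary k V
  have hW1 : (W : Matrix (powersetCard (Fin n) k) (powersetCard (Fin n) k) ℂ) *
      star (W : Matrix (powersetCard (Fin n) k) (powersetCard (Fin n) k) ℂ) = 1 :=
    mem_unitaryGroup_iff.mp W.2
  have hWu : IsUnit (W : Matrix (powersetCard (Fin n) k) (powersetCard (Fin n) k) ℂ) :=
    (Unitary.toUnits W).isUnit
  have hsub : c • (1 : Matrix (powersetCard (Fin n) k) (powersetCard (Fin n) k) ℂ) - compound k M =
      (W : Matrix (powersetCard (Fin n) k) (powersetCard (Fin n) k) ℂ) *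
        (diagonal fun I => ((c - ∏ i ∈ I.1, eigsDesc M i : ℝ) : ℂ)) *
        star (W : Matrix (powersetCard (Fin n) k) (powersetCard (Fin n) k) ℂ) := by
    have : (diagonal fun I : powersetCard (Fin n) k =>
        ((c - ∏ i ∈ I.1, eigsDesc M i : ℝ) : ℂ)) = c • 1 -
          diagonal fun I => ((∏ i ∈ I.1, eigsDesc M i : ℝ) : ℂ) := by
      rw [← diagonal_one, ← diagonal_smul, diagonal_sub]
      congr 1
      ext I
      simp [NNReal.smul_def]
    rw [this, mul_sub, sub_mul, mul_smul_comm, mul_one, smul_mul_assoc, hW1,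
      ← compound_unitary_conj_diagonal, ← hV]
  rw [← sub_nonneg, hsub, hWu.star_right_conjugate_nonneg_iff, nonneg_iff_posSemidef,
    posSemidef_diagonal_iff]
  refine forall_congr' fun I => ?_
  rw [Complex.zero_le_real, sub_nonneg]

theorem PosDef.det_rpow {n : ℕ} {M : Matrix (Fin n) (Fin n) ℂ} (hM : M.PosDef) (r : ℝ) :
    (M ^ r).det = (((∏ i, eigsDesc M i) ^ r : ℝ) : ℂ) := by
  obtain ⟨V, hV⟩ := hM.exists_unitary_conj
  conv_lhs => rw [hV, unitary_conj_diagonal_rpow V hM.eigsDesc_pos]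
  rw [det_mul_right_comm, mem_unitaryGroup_iff.mp V.2, one_mul, det_diagonal,
    ← Real.finsetProd_rpow _ _ fun i _ => (hM.eigsDesc_pos i).le]
  push_cast; rfl

theorem PosDef.rpow {n : ℕ} {M : Matrix (Fin n) (Fin n) ℂ} (hM : M.PosDef) (r : ℝ) :
    (M ^ r).PosDef :=
  isStrictlyPositive_iff_posDef.mp (.rpow M r (isStrictlyPositive_iff_posDef.mpr hM))

theorem PosDef.mul_mul_self {n : ℕ} {M N : Matrix (Fin n) (Fin n) ℂ} (hM : M.PosDef)
    (hN : N.PosDef) : (M * N * M).PosDef := by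
  have hM' := isStrictlyPositive_iff_posDef.mpr hM
  have hN' := isStrictlyPositive_iff_posDef.mpr hN
  exact isStrictlyPositive_iff_posDef.mp
    (((hM'.isUnit.mul hN'.isUnit).mul hM'.isUnit).isStrictlyPositive
      (conjugate_nonneg_of_nonneg hN'.nonneg hM'.nonneg))

theorem PosDef.geomMean_eq {n : ℕ} {A B : Matrix (Fin n) (Fin n) ℂ} (hA : A.PosDef)
    (hB : B.PosDef) (t : ℝ) :
    geomMean A B t = A ^ (1 / 2 : ℝ) *
      (A ^ (-(1 / 2) : ℝ) * B * A ^ (-(1 / 2) : ℝ)) ^ t * A ^ (1 / 2 : ℝ) := by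
  have hm := (hA.rpow (-(1 / 2))).mul_mul_self hB
  rw [geomMean, hA.mpow_eq_rpow, hA.mpow_eq_rpow, hm.mpow_eq_rpow]

end Matrix

theorem Antitone.prod_le_prod_filter_lt {n k : ℕ} {f : Fin n → ℝ} (hf : Antitone f)
    (h0 : ∀ i, 0 ≤ f i) (hk : k ≤ n) {s : Finset (Fin n)} (hs : s.card = k) :
    ∏ i ∈ s, f i ≤ ∏ i ∈ Finset.univ.filter (fun i : Fin n => (i : ℕ) < k), f i := by
  have hset : Finset.univ.filter (fun i : Fin n => (i : ℕ) < k) =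
      Finset.univ.map (Fin.castLEEmb hk) := by
    ext i
    simp only [Finset.mem_filter, Finset.mem_univ, true_and, Finset.mem_map]
    exact ⟨fun h => ⟨⟨i, h⟩, rfl⟩, by rintro ⟨j, rfl⟩; exact j.2⟩
  rw [hset, ← Finset.map_orderEmbOfFin_univ s hs, Finset.prod_map, Finset.prod_map]
  have hle : ∀ m (hm : m < k), m ≤ (s.orderEmbOfFin hs ⟨m, hm⟩ : ℕ) := by
    intro m
    induction m with
    | zero => exact fun _ => Nat.zero_le _
    | succ m ih =>
      intro hm
      have hlt : s.orderEmbOfFin hs ⟨m, by omega⟩ < s.orderEmbOfFin hs ⟨m + 1, hm⟩ :=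
        (s.orderEmbOfFin hs).strictMono (Fin.mk_lt_mk.mpr m.lt_succ_self)
      exact (ih (by omega)).trans_lt hlt
  exact Finset.prod_le_prod (fun i _ => h0 _) fun i _ => hf (hle i i.2)

theorem prod_eigsDesc_conj_geomMean_le {n : ℕ} {A B : Matrix (Fin n) (Fin n) ℂ}
    (hA : A.PosDef) (hB : B.PosDef) {t : ℝ} (ht : t ∈ Set.Icc (0 : ℝ) 1) {k : ℕ} (hk : k ≤ n) :
    ∏ i ∈ Finset.univ.filter (fun i : Fin n => (i : ℕ) < k),
        eigsDesc (mpow A (1 / 2) * geomMean A B t * mpow A (1 / 2)) i ≤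
      ∏ i ∈ Finset.univ.filter (fun i : Fin n => (i : ℕ) < k),
        eigsDesc (mpow A (1 - t / 2) * mpow B t * mpow A (1 - t / 2)) i := by
  have hm := (hA.rpow (-(1 / 2))).mul_mul_self hB
  have hL := (hA.rpow (1 / 2)).mul_mul_self ((hA.rpow (1 / 2)).mul_mul_self (hm.rpow t))
  have hR := (hA.rpow (1 - t / 2)).mul_mul_self (hB.rpow t)
  rw [hA.geomMean_eq hB, hA.mpow_eq_rpow, hA.mpow_eq_rpow, hB.mpow_eq_rpow]
  let I : powersetCard (Fin n) k :=
    ⟨Finset.univ.filter (fun i : Fin n => (i : ℕ) < k), by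
      simp [powersetCard.mem_iff, Fin.card_filter_val_lt, hk]⟩
  obtain ⟨c, hc⟩ : ∃ c : NNReal, (c : ℝ) = ∏ i ∈ I.1,
      eigsDesc (A ^ (1 - t / 2) * B ^ t * A ^ (1 - t / 2)) i :=
    CanLift.prf _ (Finset.prod_nonneg fun i _ => (hR.eigsDesc_pos i).le)
  have hc0 : c ≠ 0 := by
    rw [← NNReal.coe_ne_zero, hc]
    exact (Finset.prod_pos fun i _ => hR.eigsDesc_pos i).ne'
  have h1 := (hR.compound_le_smul_one_iff k c).mpr fun J =>
    ((eigsDesc_antitone _).prod_le_prod_filter_lt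
      (fun i => (hR.eigsDesc_pos i).le) hk J.2).trans hc.ge
  rw [compound_mul, compound_mul, hA.compound_rpow, hB.compound_rpow] at h1
  have h2 := CFC.conj_geomMean_le_smul_one (hA.isStrictlyPositive_compound k)
    (hB.isStrictlyPositive_compound k) ht hc0 h1
  simp only [← hA.compound_rpow, ← compound_mul, ← hm.compound_rpow] at h2
  exact ((hL.compound_le_smul_one_iff k c).mp h2 I).trans hc.le

theorem prod_eigsDesc_conj_geomMean_eq {n : ℕ} {A B : Matrix (Fin n) (Fin n) ℂ}
    (hA : A.PosDef) (hB : B.PosDef) (t : ℝ) :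
    ∏ i, eigsDesc (mpow A (1 / 2) * geomMean A B t * mpow A (1 / 2)) i =
      ∏ i, eigsDesc (mpow A (1 - t / 2) * mpow B t * mpow A (1 - t / 2)) i := by
  have hm := (hA.rpow (-(1 / 2))).mul_mul_self hB
  have hL := (hA.rpow (1 / 2)).mul_mul_self ((hA.rpow (1 / 2)).mul_mul_self (hm.rpow t))
  have hR := (hA.rpow (1 - t / 2)).mul_mul_self (hB.rpow t)
  rw [hA.geomMean_eq hB, hA.mpow_eq_rpow, hA.mpow_eq_rpow, hB.mpow_eq_rpow]
  have ha : 0 < ∏ i, eigsDesc A i := Finset.prod_pos fun i _ => hA.eigsDesc_pos i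
  have hb : 0 < ∏ i, eigsDesc B i := Finset.prod_pos fun i _ => hB.eigsDesc_pos i
  have hM := hm.det_eq_prod_eigsDesc
  rw [det_mul, det_mul, hA.det_rpow, hB.det_eq_prod_eigsDesc] at hM
  norm_cast at hM
  apply Complex.ofReal_injective
  rw [← hL.det_eq_prod_eigsDesc, ← hR.det_eq_prod_eigsDesc]
  simp only [det_mul, hA.det_rpow, hB.det_rpow, hm.det_rpow, ← hM]
  norm_cast
  generalize ∏ i, eigsDesc A i = a at ha
  generalize ∏ i, eigsDesc B i = b at hb
  rw [mul_right_comm (a ^ (-(1 / 2) : ℝ)), Real.mul_rpow (by positivity) hb.le,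
    mul_right_comm (a ^ (1 - t / 2)), ← Real.rpow_add ha, ← Real.rpow_add ha,
    ← Real.rpow_mul ha.le]
  calc _ = a ^ (1 / 2 : ℝ) * a ^ (1 / 2 : ℝ) * a ^ ((-(1 / 2) + -(1 / 2)) * t) *
        a ^ (1 / 2 : ℝ) * a ^ (1 / 2 : ℝ) * b ^ t := by ring
    _ = _ := by
      simp only [← Real.rpow_add ha]
      congr 2
      ring

end LogMajorization

/-- log-majorization of the eigenvalues of `A^{1/2}(A♯ₜB)A^{1/2}`
by those of `A^{1-t/2} Bᵗ A^{1-t/2}`, with equality of full products. -/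
theorem stmt_0 {n : ℕ} (A B : Matrix (Fin n) (Fin n) ℂ)
    (hA : A.PosDef) (hB : B.PosDef) (t : ℝ) (ht : t ∈ Set.Icc (0:ℝ) 1) :
    (∀ k : ℕ, 1 ≤ k → k ≤ n →
      ∏ i ∈ Finset.univ.filter (fun i : Fin n => (i : ℕ) < k),
          eigsDesc (mpow A (1/2) * geomMean A B t * mpow A (1/2)) i ≤
        ∏ i ∈ Finset.univ.filter (fun i : Fin n => (i : ℕ) < k),
          eigsDesc (mpow A (1 - t/2) * mpow B t * mpow A (1 - t/2)) i) ∧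
    (∏ i : Fin n, eigsDesc (mpow A (1/2) * geomMean A B t * mpow A (1/2)) i =
      ∏ i : Fin n, eigsDesc (mpow A (1 - t/2) * mpow B t * mpow A (1 - t/2)) i) := by
  exact ⟨fun _ _ hk => prod_eigsDesc_conj_geomMean_le hA hB ht hk,
    prod_eigsDesc_conj_geomMean_eq hA hB t⟩
end

section
/- Let A and B be n×n positive definite complex matrices and t ∈ (0,1]. If B^t ≤ A^{t−2} in the Loewner order, then (A^{−1/2} B A^{−1/2})^t ≤ A^{−2} in the Loewner order. -/
open Matrix ComplexOrder

section RealPowers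

variable {R : Type*} [CStarAlgebra R] [PartialOrder R] [StarOrderedRing R]

/-- Real powers of a strictly positive element commute with unitary conjugation. -/
lemma rpow_unitary_conjugate (u : unitary R) {x : R} (hx : IsStrictlyPositive x) (t : ℝ) :
    ((u : R) * x * star (u : R)) ^ t = (u : R) * x ^ t * star (u : R) := by
  have hcont : ContinuousOn (fun s : NNReal => s ^ t) (spectrum NNReal x) := by
    intro s hs
    have hs0 : s ≠ 0 := fun h => spectrum.zero_notMem NNReal hx.isUnit (h ▸ hs)
    exact (NNReal.continuousAt_rpow_const (Or.inl hs0)).continuousWithinAt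
  have hmap := StarAlgHomClass.map_cfc (S := ℂ) (Unitary.conjStarAlgAut ℂ R u)
    (fun s : NNReal => s ^ t) x hcont
    ((continuous_const.mul continuous_id).mul continuous_const)
    hx.nonneg
    (by simpa using star_right_conjugate_nonneg hx.nonneg (u : R))
  simpa [CFC.rpow_def] using hmap.symm

lemma rpow_mul_star_self {y : R} (hy : IsUnit y) (t : ℝ) :
    (y * star y) ^ t = y * (star y * y) ^ (t - 1) * star y := by
  set x := star y * y with hx
  have hxpos : IsStrictlyPositive x := (hy.star.mul hy).isStrictlyPositive (star_mul_self_nonneg y)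
  set p := x ^ (-(1 / 2) : ℝ) with hp
  have hpstar : star p = p := (IsSelfAdjoint.of_nonneg CFC.rpow_nonneg).star_eq
  have hpxp (s : ℝ) : p * x ^ s * p = x ^ (s - 1) := by
    rw [hp, ← CFC.rpow_add hxpos.isUnit, ← CFC.rpow_add hxpos.isUnit]
    congr 1
    ring
  have hpxp_one : p * x * p = 1 := by
    simpa [CFC.rpow_one x hxpos.nonneg, CFC.rpow_zero x hxpos.nonneg] using hpxp 1
  have hunit : y * p ∈ unitary R := by
    have hl : star (y * p) * (y * p) = 1 := by
      rw [star_mul, hpstar, ← hpxp_one, hx]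
      simp only [mul_assoc]
    have hu : IsUnit (y * p) := hy.mul (hxpos.isUnit.cfcRpow _ hxpos.nonneg)
    refine ⟨hl, ?_⟩
    obtain ⟨v, hv⟩ := hu
    rw [← hv] at hl ⊢
    rw [← Units.inv_eq_of_mul_eq_one_left hl, Units.mul_inv]
  have hconj (z : R) : y * p * z * star (y * p) = y * (p * z * p) * star y := by
    rw [star_mul, hpstar]
    simp only [mul_assoc]
  have h := rpow_unitary_conjugate ⟨y * p, hunit⟩ hxpos t
  simp only [hconj, hpxp, hpxp_one, mul_one] at h
  exact h

lemma rpow_le_rpow_of_nonpos {a b : R} (ha : IsStrictlyPositive a) (hab : a ≤ b) {s : ℝ}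
    (hs : s ∈ Set.Ico (-1 : ℝ) 0) : b ^ s ≤ a ^ s := by
  have hb : IsStrictlyPositive b := ha.of_le hab
  have hs' : -s ≠ 0 := neg_ne_zero.mpr hs.2.ne
  have h := CStarAlgebra.rpow_neg_one_le_rpow_neg_one
    (CFC.rpow_le_rpow (p := -s) ⟨by linarith [hs.2], by linarith [hs.1]⟩ hab) (ha.rpow a (-s))
  rwa [CFC.rpow_rpow a _ _ hs' ha, CFC.rpow_rpow b _ _ hs' hb, mul_neg_one, neg_neg] at h

/-- A case of the Furuta inequality. -/
theorem conjugate_rpow_le_sq {b c : R} (hb : IsStrictlyPositive b) (hc : IsStrictlyPositive c)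
    {t : ℝ} (ht0 : 0 < t) (ht1 : t ≤ 1) (h : b ^ t ≤ c ^ (2 - t)) :
    (c ^ (1 / 2 : ℝ) * b * c ^ (1 / 2 : ℝ)) ^ t ≤ c ^ (2 : ℝ) := by
  have h2t : 0 < 2 - t := by linarith
  have hpow : b ^ (t / (2 - t)) ≤ c := by
    have := CFC.rpow_le_rpow (p := (2 - t)⁻¹)
      ⟨by positivity, inv_le_one_of_one_le₀ (by linarith)⟩ h
    rwa [CFC.rpow_rpow b _ _ ht0.ne' hb, CFC.rpow_rpow_inv c _ h2t.ne' hc,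
      ← div_eq_mul_inv] at this
  set q := c ^ (1 / 2 : ℝ) with hq
  set p := b ^ (1 / 2 : ℝ) with hp
  have hqstar : star q = q := (IsSelfAdjoint.of_nonneg CFC.rpow_nonneg).star_eq
  have hpstar : star p = p := (IsSelfAdjoint.of_nonneg CFC.rpow_nonneg).star_eq
  have hpsp (s : ℝ) : p * b ^ s * p = b ^ (1 + s) := by
    rw [hp, ← CFC.rpow_add hb.isUnit, ← CFC.rpow_add hb.isUnit]
    congr 1
    ring
  have hpp : p * p = b := by
    rw [hp, ← CFC.rpow_add hb.isUnit]
    norm_num [CFC.rpow_one b hb.nonneg]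
  have hqq : q * q = c := by
    rw [hq, ← CFC.rpow_add hc.isUnit]
    norm_num [CFC.rpow_one c hc.nonneg]
  have hqcq : q * c * q = c ^ (2 : ℝ) := by
    calc q * c * q = q * c ^ (1 : ℝ) * q := by rw [CFC.rpow_one c hc.nonneg]
      _ = c ^ (2 : ℝ) := by
        rw [hq, ← CFC.rpow_add hc.isUnit, ← CFC.rpow_add hc.isUnit]
        norm_num
  rcases ht1.eq_or_lt with rfl | ht1
  · norm_num [CFC.rpow_one _ hb.nonneg] at hpow
    have hnonneg : 0 ≤ q * b * q := conjugate_nonneg_of_nonneg hb.nonneg CFC.rpow_nonneg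
    rw [CFC.rpow_one _ hnonneg, ← hqcq]
    exact conjugate_le_conjugate_of_nonneg hpow CFC.rpow_nonneg
  have hunit : IsUnit (q * p) :=
    (hc.isUnit.cfcRpow _ hc.nonneg).mul (hb.isUnit.cfcRpow _ hb.nonneg)
  have hleft : (q * p) * star (q * p) = q * b * q := by
    rw [star_mul, hpstar, hqstar, ← hpp]
    simp only [mul_assoc]
  have hright : star (q * p) * (q * p) = p * c * p := by
    rw [star_mul, hpstar, hqstar, ← hqq]
    simp only [mul_assoc]
  have hne : 1 + t / (2 - t) ≠ 0 := by positivity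
  have hmid : (p * c * p) ^ (t - 1) ≤ b ^ ((1 + t / (2 - t)) * (t - 1)) := by
    rw [← CFC.rpow_rpow b _ _ hne hb]
    refine rpow_le_rpow_of_nonpos (hb.rpow b _) ?_ ⟨by linarith, by linarith⟩
    rw [← hpsp]
    exact conjugate_le_conjugate_of_nonneg hpow CFC.rpow_nonneg
  have hexp : 1 + (1 + t / (2 - t)) * (t - 1) = t / (2 - t) := by
    field_simp
    ring
  calc (q * b * q) ^ t = q * (p * (p * c * p) ^ (t - 1) * p) * q := by
        rw [← hleft, rpow_mul_star_self hunit, hright, star_mul, hpstar, hqstar]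
        simp only [mul_assoc]
    _ ≤ q * (p * b ^ ((1 + t / (2 - t)) * (t - 1)) * p) * q :=
        conjugate_le_conjugate_of_nonneg
          (conjugate_le_conjugate_of_nonneg hmid CFC.rpow_nonneg) CFC.rpow_nonneg
    _ = q * b ^ (t / (2 - t)) * q := by rw [hpsp, hexp]
    _ ≤ q * c * q := conjugate_le_conjugate_of_nonneg hpow CFC.rpow_nonneg
    _ = c ^ (2 : ℝ) := hqcq

end RealPowers

open scoped MatrixOrder Matrix.Norms.L2Operator in
lemma mpow_eq_rpow {n : ℕ} {A : Matrix (Fin n) (Fin n) ℂ} (hA : A.PosDef) (r : ℝ) :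
    mpow A r = A ^ r := by
  rw [CFC.rpow_eq_cfc_real hA.posSemidef.nonneg, hA.isHermitian.cfc_eq, mpow,
    dif_pos hA.isHermitian, Matrix.IsHermitian.cfc, Unitary.conjStarAlgAut_apply]
  rfl

/-- if `Bᵗ ≤ A^{t-2}` in the Loewner order then
`(A^{-1/2} B A^{-1/2})ᵗ ≤ A^{-2}`. -/
theorem stmt_2 {n : ℕ} (A B : Matrix (Fin n) (Fin n) ℂ)
    (hA : A.PosDef) (hB : B.PosDef) (t : ℝ) (ht : t ∈ Set.Ioc (0:ℝ) 1)
    (h : (mpow A (t - 2) - mpow B t).PosSemidef) :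
    (mpow A (-2) - mpow (mpow A (-(1/2)) * B * mpow A (-(1/2))) t).PosSemidef := by
  open scoped MatrixOrder Matrix.Norms.L2Operator in
  have hA' : IsStrictlyPositive A := Matrix.isStrictlyPositive_iff_posDef.mpr hA
  have hB' : IsStrictlyPositive B := Matrix.isStrictlyPositive_iff_posDef.mpr hB
  have hAinv (s : ℝ) : (A ^ (-1 : ℝ)) ^ s = A ^ (-s) := by
    rw [CFC.rpow_rpow A _ _ (by norm_num) hA', neg_one_mul]
  have hM : (A ^ (-(1 / 2) : ℝ) * B * A ^ (-(1 / 2) : ℝ)).PosDef :=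
    Matrix.isStrictlyPositive_iff_posDef.mp <|
      IsStrictlyPositive.conjugate_of_isUnit_of_isSelfAdjoint B _ (hA'.rpow A _).isUnit
        (hA'.rpow A _).isSelfAdjoint hB'
  rw [mpow_eq_rpow hA, mpow_eq_rpow hB, ← Matrix.le_iff] at h
  rw [mpow_eq_rpow hA, mpow_eq_rpow hA, mpow_eq_rpow hM, ← Matrix.le_iff]
  have key := conjugate_rpow_le_sq hB' (hA'.rpow A (-1)) ht.1 ht.2
    (by rwa [hAinv, neg_sub])
  rwa [hAinv, hAinv] at key
end

section
/- Let A and B be n×n positive definite complex matrices and t ∈ [0,1]. Then Tr(A(A♯_t B)) ≤ Tr(A^{2−t} B^t). -/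
open Matrix ComplexOrder

/-- The complex diagonal matrix with the given real entries. -/
noncomputable def realDiag {n : ℕ} (f : Fin n → ℝ) : Matrix (Fin n) (Fin n) ℂ :=
  diagonal fun i => (f i : ℂ)

section realDiag

variable {n : ℕ}

lemma realDiag_mul (f g : Fin n → ℝ) :
    realDiag f * realDiag g = realDiag fun i => f i * g i := by
  simp [realDiag, diagonal_mul_diagonal]

lemma realDiag_mul_assoc (f g : Fin n → ℝ) (X : Matrix (Fin n) (Fin n) ℂ) :
    realDiag f * (realDiag g * X) = realDiag (fun i => f i * g i) * X := by
  rw [← Matrix.mul_assoc, realDiag_mul]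

lemma realDiag_eq_one {f : Fin n → ℝ} (hf : ∀ i, f i = 1) : realDiag f = 1 := by
  simp [realDiag, hf]

lemma conjTranspose_realDiag (f : Fin n → ℝ) : (realDiag f)ᴴ = realDiag f := by
  simp only [realDiag, diagonal_conjTranspose]
  congr 1
  ext i
  simp

lemma trace_realDiag_mul_conj (g f : Fin n → ℝ) (W : Matrix (Fin n) (Fin n) ℂ) :
    (realDiag g * (W * realDiag f * Wᴴ)).trace =
      ((∑ i, ∑ k, g i * f k * Complex.normSq (W i k) : ℝ) : ℂ) := by
  simp only [realDiag, trace, diag_apply, diagonal_mul]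
  push_cast
  refine Finset.sum_congr rfl fun i _ => ?_
  rw [mul_apply, Finset.mul_sum]
  refine Finset.sum_congr rfl fun k _ => ?_
  rw [mul_diagonal, conjTranspose_apply, Complex.normSq_eq_conj_mul_self]
  simp only [Complex.star_def]
  ring

lemma trace_conjTranspose_mul_realDiag_mul (d : Fin n → ℝ) (P : Matrix (Fin n) (Fin n) ℂ) :
    (Pᴴ * realDiag d * P).trace = ((∑ i, ∑ j, d j * Complex.normSq (P j i) : ℝ) : ℂ) := by
  simpa [realDiag_eq_one (f := fun _ : Fin n => (1 : ℝ)) fun _ => rfl] using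
    trace_realDiag_mul_conj (fun _ => 1) d Pᴴ

lemma conj_realDiag_mul_conj {W : Matrix (Fin n) (Fin n) ℂ} (hW : Wᴴ * W = 1)
    (f g : Fin n → ℝ) :
    (W * realDiag f * Wᴴ) * (W * realDiag g * Wᴴ) = W * realDiag (fun i => f i * g i) * Wᴴ := by
  rw [← realDiag_mul]
  simp only [Matrix.mul_assoc]
  rw [← Matrix.mul_assoc Wᴴ W, hW, Matrix.one_mul]

lemma conjTranspose_conj_realDiag (W : Matrix (Fin n) (Fin n) ℂ) (f : Fin n → ℝ) :
    (W * realDiag f * Wᴴ)ᴴ = W * realDiag f * Wᴴ := by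
  simp [conjTranspose_mul, conjTranspose_realDiag, Matrix.mul_assoc]

/-- The entries of a Hermitian matrix satisfy `∑ aᵢ aⱼ |Nᵢⱼ|² ≤ ∑ aᵢ² |Nᵢⱼ|²`. -/
lemma sum_mul_mul_normSq_le {N : Matrix (Fin n) (Fin n) ℂ} (hN : Nᴴ = N) (a : Fin n → ℝ) :
    ∑ i, ∑ j, a i * a j * Complex.normSq (N i j) ≤
      ∑ i, ∑ j, a i ^ 2 * Complex.normSq (N i j) := by
  have hsymm : ∑ i, ∑ j, a j ^ 2 * Complex.normSq (N i j) =
      ∑ i, ∑ j, a i ^ 2 * Complex.normSq (N i j) := by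
    rw [Finset.sum_comm]
    refine Finset.sum_congr rfl fun i _ => Finset.sum_congr rfl fun j _ => ?_
    conv_lhs => rw [← hN, conjTranspose_apply, Complex.star_def, Complex.normSq_conj]
  have h : ∑ i, ∑ j, 2 * (a i * a j * Complex.normSq (N i j)) ≤
      ∑ i, ∑ j, (a i ^ 2 * Complex.normSq (N i j) + a j ^ 2 * Complex.normSq (N i j)) :=
    Finset.sum_le_sum fun i _ => Finset.sum_le_sum fun j _ => by
      nlinarith [mul_nonneg (sq_nonneg (a i - a j)) (Complex.normSq_nonneg (N i j))]
  simp only [Finset.sum_add_distrib, hsymm] at h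
  simp only [← Finset.mul_sum] at h ⊢
  linarith

lemma two_mul_re_sub_le {x : ℝ} (hx : 0 < x) (p e : ℂ) :
    2 * (star p * e).re - x⁻¹ * Complex.normSq p ≤ x * Complex.normSq e := by
  have h := mul_nonneg (inv_nonneg.2 hx.le) (Complex.normSq_nonneg (p - x * e))
  have hexp : x⁻¹ * Complex.normSq (p - x * e) =
      x⁻¹ * Complex.normSq p - 2 * (star p * e).re + x * Complex.normSq e := by
    simp only [Complex.normSq_apply, Complex.sub_re, Complex.sub_im, Complex.mul_re,
      Complex.mul_im, Complex.ofReal_re, Complex.ofReal_im, Complex.star_def, Complex.conj_re,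
      Complex.conj_im]
    field_simp
    ring
  linarith

/-- The trace inequality for the functions `x ↦ x / (s + x)`, in an eigenbasis of `A`. -/
lemma sum_div_add_le {V W : Matrix (Fin n) (Fin n) ℂ} {a b c : Fin n → ℝ}
    (hV : Vᴴ * V = 1) (hW : Wᴴ * W = 1) (ha : ∀ i, 0 < a i) (hb : ∀ i, 0 < b i)
    (hc : ∀ i, 0 < c i)
    (h : realDiag (fun i => √(a i)) * (W * realDiag c * Wᴴ) * realDiag (fun i => √(a i)) =
      V * realDiag b * Vᴴ) {s : ℝ} (hs : 0 < s) :
    ∑ i, ∑ k, a i ^ 2 * Complex.normSq (W i k) * (c k / (s + c k)) ≤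
      ∑ i, ∑ j, a i ^ 2 * Complex.normSq (V i j) * ((b j / a i) / (s + b j / a i)) := by
  have hV' : V * Vᴴ = 1 := mul_eq_one_comm.1 hV
  have hW' : W * Wᴴ = 1 := mul_eq_one_comm.1 hW
  have hsq (i) : √(a i) * √(a i) = a i := Real.mul_self_sqrt (ha i).le
  have hsq0 (i) : √(a i) ≠ 0 := (Real.sqrt_pos.2 (ha i)).ne'
  set R := realDiag fun i => √(a i) with hR
  set R' := realDiag fun i => (√(a i))⁻¹ with hR'
  have hRR' : R * R' = 1 := by
    rw [hR, hR', realDiag_mul]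
    exact realDiag_eq_one fun i => mul_inv_cancel₀ (hsq0 i)
  have hRR : R * R = realDiag a := by simp [hR, realDiag_mul, hsq]
  have hRH : Rᴴ = R := conjTranspose_realDiag _
  have hinv : V * realDiag (fun j => (b j)⁻¹) * Vᴴ =
      R' * (W * realDiag (fun k => (c k)⁻¹) * Wᴴ) * R' := by
    have h1 : (V * realDiag b * Vᴴ) * (V * realDiag (fun j => (b j)⁻¹) * Vᴴ) = 1 := by
      rw [conj_realDiag_mul_conj hV, realDiag_eq_one fun i => mul_inv_cancel₀ (hb i).ne',
        Matrix.mul_one, hV']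
    have h2 : (V * realDiag b * Vᴴ) * (R' * (W * realDiag (fun k => (c k)⁻¹) * Wᴴ) * R') = 1 := by
      rw [← h]
      calc _ = R * (W * realDiag c * Wᴴ) * (R * R') *
            (W * realDiag (fun k => (c k)⁻¹) * Wᴴ) * R' := by simp only [Matrix.mul_assoc]
        _ = R * ((W * realDiag c * Wᴴ) * (W * realDiag (fun k => (c k)⁻¹) * Wᴴ)) * R' := by
          rw [hRR', Matrix.mul_one]; simp only [Matrix.mul_assoc]
        _ = 1 := by
          rw [conj_realDiag_mul_conj hW, realDiag_eq_one fun i => mul_inv_cancel₀ (hc i).ne',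
            Matrix.mul_one, hW', Matrix.mul_one, hRR']
    rw [← inv_eq_right_inv h1, inv_eq_right_inv h2]
  set f : Fin n → ℝ := fun k => s * (c k / (s + c k)) with hf
  set N := W * realDiag f * Wᴴ with hN
  have hNH : Nᴴ = N := conjTranspose_conj_realDiag W f
  set P := Vᴴ * (R * N * realDiag a) with hP
  set E := Vᴴ * R with hE
  have hPH : Pᴴ = realDiag a * N * R * V := by
    simp [hP, conjTranspose_mul, hNH, hRH, conjTranspose_realDiag, Matrix.mul_assoc]
  have hR'R : R' * R = 1 := mul_eq_one_comm.1 hRR'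
  have hcross : ∑ i, ∑ j, (star (P j i) * E j i).re =
      ∑ i, ∑ k, a i ^ 2 * f k * Complex.normSq (W i k) := by
    have h1 : (Pᴴ * E).trace = (realDiag (fun i => a i ^ 2) * N).trace := by
      rw [hPH, hE]
      calc _ = (realDiag a * N * R * (V * Vᴴ) * R).trace := by simp only [Matrix.mul_assoc]
        _ = (realDiag a * N * (R * R)).trace := by
          rw [hV', Matrix.mul_one]; simp only [Matrix.mul_assoc]
        _ = _ := by rw [hRR, trace_mul_comm, realDiag_mul_assoc]; simp only [sq]
    rw [hN, trace_realDiag_mul_conj] at h1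
    have h2 := congrArg Complex.re h1
    simpa only [trace, diag_apply, mul_apply, conjTranspose_apply, Complex.re_sum,
      Complex.ofReal_re] using h2
  have hleft : ∑ i, ∑ j, (b j)⁻¹ * Complex.normSq (P j i) =
      ∑ i, ∑ k, a i ^ 2 * (f k * (c k)⁻¹ * f k) * Complex.normSq (W i k) := by
    have h1 : (Pᴴ * realDiag (fun j => (b j)⁻¹) * P).trace =
        (realDiag (fun i => a i ^ 2) * (W * realDiag (fun k => f k * (c k)⁻¹ * f k) * Wᴴ)).trace := by
      rw [hPH, hP]
      calc _ = (realDiag a * N * R * (V * realDiag (fun j => (b j)⁻¹) * Vᴴ) *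
            R * N * realDiag a).trace := by simp only [Matrix.mul_assoc]
        _ = (realDiag a * N * (R * R') * (W * realDiag (fun k => (c k)⁻¹) * Wᴴ) * (R' * R) *
            N * realDiag a).trace := by rw [hinv]; simp only [Matrix.mul_assoc]
        _ = (realDiag a * ((N * (W * realDiag (fun k => (c k)⁻¹) * Wᴴ)) * N) *
            realDiag a).trace := by
          rw [hRR', hR'R, Matrix.mul_one, Matrix.mul_one]; simp only [Matrix.mul_assoc]
        _ = _ := by
          rw [hN, conj_realDiag_mul_conj hW, conj_realDiag_mul_conj hW, trace_mul_comm,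
            realDiag_mul_assoc]
          simp only [sq]
    rw [trace_realDiag_mul_conj, trace_conjTranspose_mul_realDiag_mul] at h1
    exact_mod_cast h1
  have hright : ∑ i, ∑ j, (s * a i)⁻¹ * Complex.normSq (P j i) ≤
      ∑ i, ∑ k, a i ^ 2 * (s⁻¹ * (f k * f k)) * Complex.normSq (W i k) := by
    have h1 : ∑ j, ∑ i, (s * a i)⁻¹ * Complex.normSq (P j i) =
        ∑ i, ∑ j, s⁻¹ * (a i * a j * Complex.normSq (N i j)) := by
      have h2 : (P * realDiag (fun i => (s * a i)⁻¹) * Pᴴ).trace =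
          ((R * N * realDiag a) * realDiag (fun i => (s * a i)⁻¹) * (R * N * realDiag a)ᴴ).trace := by
        calc _ = (Vᴴ * ((R * N * realDiag a) * realDiag (fun i => (s * a i)⁻¹) *
              (R * N * realDiag a)ᴴ * V)).trace := by
              rw [hP, conjTranspose_mul, conjTranspose_conjTranspose]
              simp only [Matrix.mul_assoc]
          _ = _ := by rw [trace_mul_comm, Matrix.mul_assoc, hV', Matrix.mul_one]
      have h3 (X : Matrix (Fin n) (Fin n) ℂ) (d : Fin n → ℝ) :=
        trace_realDiag_mul_conj (fun _ => 1) d X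
      simp only [realDiag_eq_one (f := fun _ : Fin n => (1 : ℝ)) fun _ => rfl,
        one_mul] at h3
      rw [h3, h3] at h2
      have h4 : ∑ j, ∑ i, (s * a i)⁻¹ * Complex.normSq (P j i) =
        ∑ j, ∑ i, (s * a i)⁻¹ * Complex.normSq ((R * N * realDiag a) j i) := by exact_mod_cast h2
      rw [h4]
      refine Finset.sum_congr rfl fun i _ => Finset.sum_congr rfl fun j _ => ?_
      have ha' := (ha j).ne'
      rw [hR, realDiag, realDiag, mul_diagonal, diagonal_mul, Complex.normSq_mul,
        Complex.normSq_mul, Complex.normSq_ofReal, Complex.normSq_ofReal, hsq]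
      field_simp
    have h5 : ∑ i, ∑ j, a i ^ 2 * Complex.normSq (N i j) =
        ∑ i, ∑ k, a i ^ 2 * (f k * f k) * Complex.normSq (W i k) := by
      have h6 := trace_realDiag_mul_conj (fun i => a i ^ 2) (fun _ => 1) N
      rw [realDiag_eq_one (f := fun _ : Fin n => (1 : ℝ)) fun _ => rfl, Matrix.mul_one, hNH,
        hN, conj_realDiag_mul_conj hW, trace_realDiag_mul_conj] at h6
      simp only [mul_one] at h6
      exact_mod_cast h6.symm
    rw [Finset.sum_comm, h1]
    simp only [← Finset.mul_sum]
    calc _ ≤ s⁻¹ * ∑ i, ∑ j, a i ^ 2 * Complex.normSq (N i j) :=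
          mul_le_mul_of_nonneg_left (sum_mul_mul_normSq_le hNH a) (inv_nonneg.2 hs.le)
      _ = _ := by
        rw [h5]
        simp only [Finset.mul_sum]
        refine Finset.sum_congr rfl fun i _ => Finset.sum_congr rfl fun j _ => ?_
        ring
  have hpoint : ∑ i, ∑ j, (2 * (star (P j i) * E j i).re - ((b j)⁻¹ * Complex.normSq (P j i) +
        (s * a i)⁻¹ * Complex.normSq (P j i))) ≤
      ∑ i, ∑ j, s * (a i ^ 2 * Complex.normSq (V i j) * ((b j / a i) / (s + b j / a i))) := by
    refine Finset.sum_le_sum fun i _ => Finset.sum_le_sum fun j _ => ?_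
    have hai := ha i
    have hbj := hb j
    have hx : 0 < ((b j)⁻¹ + (s * a i)⁻¹)⁻¹ := by positivity
    have h1 := two_mul_re_sub_le hx (P j i) (E j i)
    rw [inv_inv, add_mul] at h1
    refine h1.trans_eq ?_
    rw [hE, hR, realDiag, mul_diagonal, Complex.normSq_mul, conjTranspose_apply,
      Complex.star_def, Complex.normSq_conj, Complex.normSq_ofReal, hsq]
    field_simp
  have hfinal : ∑ i, ∑ k, s * (a i ^ 2 * Complex.normSq (W i k) * (c k / (s + c k))) =
      2 * (∑ i, ∑ k, a i ^ 2 * f k * Complex.normSq (W i k)) -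
      (∑ i, ∑ k, a i ^ 2 * (f k * (c k)⁻¹ * f k) * Complex.normSq (W i k) +
        ∑ i, ∑ k, a i ^ 2 * (s⁻¹ * (f k * f k)) * Complex.normSq (W i k)) := by
    simp only [Finset.mul_sum, ← Finset.sum_sub_distrib, ← Finset.sum_add_distrib]
    refine Finset.sum_congr rfl fun i _ => Finset.sum_congr rfl fun k _ => ?_
    have hck := hc k
    simp only [hf]
    field_simp
    ring
  simp only [Finset.sum_sub_distrib, Finset.sum_add_distrib, ← Finset.mul_sum] at hpoint hfinal hright
  rw [hcross, hleft] at hpoint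
  exact le_of_mul_le_mul_left (by linarith) hs

end realDiag

section integral

open MeasureTheory Set

/-- An inequality between linear combinations of `x / (s + x)` for all `s > 0` passes to
the powers `x ^ t` with `0 < t < 1`. -/
lemma sum_rpow_le_of_sum_div_add_le.{u} {ι κ : Type u} [Fintype ι] [Fintype κ] {p x : ι → ℝ}
    {q y : κ → ℝ} (hx : ∀ i, 0 ≤ x i) (hy : ∀ k, 0 ≤ y k)
    (h : ∀ s : ℝ, 0 < s → ∑ i, p i * (x i / (s + x i)) ≤ ∑ k, q k * (y k / (s + y k)))
    {t : ℝ} (ht : t ∈ Ioo (0 : ℝ) 1) :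
    ∑ i, p i * x i ^ t ≤ ∑ k, q k * y k ^ t := by
  obtain ⟨μ, hμ⟩ := Real.exists_measure_rpow_eq_integral_rpowIntegrand₀₁ ht
  have h_int {σ : Type u} [Fintype σ] (p x : σ → ℝ) (hx : ∀ i, 0 ≤ x i) :
      IntegrableOn (fun s => ∑ i, p i * Real.rpowIntegrand₀₁ t s (x i)) (Ioi 0) μ ∧
      ∑ i, p i * x i ^ t = ∫ s in Ioi 0, ∑ i, p i * Real.rpowIntegrand₀₁ t s (x i) ∂μ := by
    have hi (i) := ((hμ (x i) (hx i)).1).const_mul (p i)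
    refine ⟨integrable_finsetSum _ fun i _ => hi i, ?_⟩
    rw [integral_finsetSum _ fun i _ => hi i]
    refine Finset.sum_congr rfl fun i _ => ?_
    rw [integral_const_mul, ← (hμ (x i) (hx i)).2]
  rw [(h_int p x hx).2, (h_int q y hy).2]
  refine setIntegral_mono_on (h_int p x hx).1 (h_int q y hy).1 measurableSet_Ioi fun s hs => ?_
  have hs' : 0 < s := hs
  have hsum {σ : Type u} [Fintype σ] (p x : σ → ℝ) (hx : ∀ i, 0 ≤ x i) :
      ∑ i, p i * Real.rpowIntegrand₀₁ t s (x i) =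
        s ^ (t - 1) * ∑ i, p i * (x i / (s + x i)) := by
    rw [Finset.mul_sum]
    refine Finset.sum_congr rfl fun i _ => ?_
    rw [Real.rpowIntegrand₀₁_eq_pow_div ht hs'.le (hx i)]
    ring
  rw [hsum p x hx, hsum q y hy]
  exact mul_le_mul_of_nonneg_left (h s hs') (Real.rpow_nonneg hs'.le _)

end integral

/-- The trace inequality written in an eigenbasis of `A`. -/
lemma sum_rpow_le {n : ℕ} {V W : Matrix (Fin n) (Fin n) ℂ} {a b c : Fin n → ℝ}
    (hV : Vᴴ * V = 1) (hW : Wᴴ * W = 1) (ha : ∀ i, 0 < a i) (hb : ∀ i, 0 < b i)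
    (hc : ∀ i, 0 < c i)
    (h : realDiag (fun i => √(a i)) * (W * realDiag c * Wᴴ) * realDiag (fun i => √(a i)) =
      V * realDiag b * Vᴴ) {t : ℝ} (ht : t ∈ Set.Icc (0 : ℝ) 1) :
    ∑ i, ∑ k, a i ^ 2 * c k ^ t * Complex.normSq (W i k) ≤
      ∑ i, ∑ j, a i ^ (2 - t) * b j ^ t * Complex.normSq (V i j) := by
  have hopen (t : ℝ) (ht : t ∈ Set.Ioo (0 : ℝ) 1) :
      ∑ i, ∑ k, a i ^ 2 * c k ^ t * Complex.normSq (W i k) ≤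
        ∑ i, ∑ j, a i ^ (2 - t) * b j ^ t * Complex.normSq (V i j) := by
    have h1 := sum_rpow_le_of_sum_div_add_le
      (p := fun z : Fin n × Fin n => a z.1 ^ 2 * Complex.normSq (W z.1 z.2))
      (x := fun z => c z.2)
      (q := fun z : Fin n × Fin n => a z.1 ^ 2 * Complex.normSq (V z.1 z.2))
      (y := fun z => b z.2 / a z.1) (fun z => (hc _).le) (fun z => (div_pos (hb _) (ha _)).le)
      (fun s hs => by
        simp only [Fintype.sum_prod_type]
        exact sum_div_add_le hV hW ha hb hc h hs) ht
    simp only [Fintype.sum_prod_type] at h1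
    refine Eq.trans_le ?_ (h1.trans_eq ?_)
    all_goals refine Finset.sum_congr rfl fun i _ => Finset.sum_congr rfl fun k _ => ?_
    · ring
    · rw [Real.div_rpow (hb _).le (ha _).le, Real.rpow_sub (ha _), Real.rpow_two]
      ring
  rw [← closure_Ioo (zero_ne_one' ℝ)] at ht
  refine le_on_closure (f := fun t : ℝ => ∑ i, ∑ k, a i ^ 2 * c k ^ t * Complex.normSq (W i k))
    (g := fun t : ℝ => ∑ i, ∑ j, a i ^ (2 - t) * b j ^ t * Complex.normSq (V i j)) hopen ?_ ?_ ht
  all_goals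
    refine Continuous.continuousOn ?_
    refine continuous_finsetSum _ fun i _ => continuous_finsetSum _ fun k _ => ?_
  · exact (continuous_const.mul
      (continuous_const.rpow continuous_id fun _ => .inl (hc k).ne')).mul continuous_const
  · exact (((continuous_const.rpow (continuous_const.sub continuous_id)
      fun _ => .inl (ha i).ne')).mul
      (continuous_const.rpow continuous_id fun _ => .inl (hb k).ne')).mul continuous_const

section mpow

variable {n : ℕ} {A : Matrix (Fin n) (Fin n) ℂ}

/-- A positive definite matrix and its powers, simultaneously diagonalized. -/
lemma Matrix.PosDef.exists_mpow_eq (hA : A.PosDef) :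
    ∃ (U : Matrix (Fin n) (Fin n) ℂ) (a : Fin n → ℝ), Uᴴ * U = 1 ∧ (∀ i, 0 < a i) ∧
      A = U * realDiag a * Uᴴ ∧ ∀ r, mpow A r = U * realDiag (fun i => a i ^ r) * Uᴴ := by
  refine ⟨hA.isHermitian.eigenvectorUnitary, hA.isHermitian.eigenvalues,
    Unitary.coe_star_mul_self _, hA.eigenvalues_pos, ?_, fun r => ?_⟩
  · conv_lhs => rw [hA.isHermitian.spectral_theorem, Unitary.conjStarAlgAut_apply]
    rfl
  · rw [mpow, dif_pos hA.isHermitian]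
    rfl

end mpow

/-- `Tr(A(A♯ₜB)) ≤ Tr(A^{2-t} Bᵗ)`. -/
theorem stmt_3 {n : ℕ} (A B : Matrix (Fin n) (Fin n) ℂ)
    (hA : A.PosDef) (hB : B.PosDef) (t : ℝ) (ht : t ∈ Set.Icc (0:ℝ) 1) :
    (A * geomMean A B t).trace ≤ (mpow A (2 - t) * mpow B t).trace := by
  obtain ⟨U, a, hU, ha, hAeq, hAp⟩ := hA.exists_mpow_eq
  obtain ⟨V, b, hV, hb, hBeq, hBp⟩ := hB.exists_mpow_eq
  have hU' : U * Uᴴ = 1 := mul_eq_one_comm.1 hU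
  have hinvl : mpow A (1 / 2) * mpow A (-(1 / 2)) = 1 := by
    rw [hAp, hAp, conj_realDiag_mul_conj hU, realDiag_eq_one, Matrix.mul_one, hU']
    intro i
    rw [← Real.rpow_add (ha i), add_neg_cancel, Real.rpow_zero]
  have hinvr : mpow A (-(1 / 2)) * mpow A (1 / 2) = 1 := mul_eq_one_comm.1 hinvl
  have hC : (mpow A (-(1 / 2)) * B * mpow A (-(1 / 2))).PosDef := by
    have hH : (mpow A (-(1 / 2)))ᴴ = mpow A (-(1 / 2)) := by
      rw [hAp, conjTranspose_conj_realDiag]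
    have hunit : IsUnit (mpow A (-(1 / 2))) := IsUnit.of_mul_eq_one _ hinvr
    have h := hunit.posDef_star_left_conjugate_iff.2 hB
    rwa [star_eq_conjTranspose, hH] at h
  obtain ⟨W, c, hW, hc, hCeq, hCp⟩ := hC.exists_mpow_eq
  have hsqrt (i) : a i ^ (1 / 2 : ℝ) = √(a i) := (Real.sqrt_eq_rpow (a i)).symm
  have hUV : (Uᴴ * V)ᴴ * (Uᴴ * V) = 1 := by
    rw [conjTranspose_mul, conjTranspose_conjTranspose, Matrix.mul_assoc, ← Matrix.mul_assoc U,
      hU', Matrix.one_mul, hV]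
  have hUW : (Uᴴ * W)ᴴ * (Uᴴ * W) = 1 := by
    rw [conjTranspose_mul, conjTranspose_conjTranspose, Matrix.mul_assoc, ← Matrix.mul_assoc U,
      hU', Matrix.one_mul, hW]
  have hrel : realDiag (fun i => √(a i)) * ((Uᴴ * W) * realDiag c * (Uᴴ * W)ᴴ) *
      realDiag (fun i => √(a i)) = (Uᴴ * V) * realDiag b * (Uᴴ * V)ᴴ := by
    have h1 : mpow A (1 / 2) * (W * realDiag c * Wᴴ) * mpow A (1 / 2) = V * realDiag b * Vᴴ := by
      rw [← hCeq, ← hBeq]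
      calc _ = (mpow A (1 / 2) * mpow A (-(1 / 2))) * B *
            (mpow A (-(1 / 2)) * mpow A (1 / 2)) := by simp only [Matrix.mul_assoc]
        _ = B := by rw [hinvl, hinvr, Matrix.one_mul, Matrix.mul_one]
    rw [hAp] at h1
    simp only [hsqrt] at h1
    calc _ = (Uᴴ * U) * realDiag (fun i => √(a i)) * ((Uᴴ * W) * realDiag c * (Uᴴ * W)ᴴ) *
          realDiag (fun i => √(a i)) * (Uᴴ * U) := by rw [hU, Matrix.one_mul, Matrix.mul_one]
      _ = Uᴴ * (U * realDiag (fun i => √(a i)) * Uᴴ * (W * realDiag c * Wᴴ) *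
          (U * realDiag (fun i => √(a i)) * Uᴴ)) * U := by
        simp only [conjTranspose_mul, conjTranspose_conjTranspose, Matrix.mul_assoc]
      _ = _ := by
        rw [h1]
        simp only [conjTranspose_mul, conjTranspose_conjTranspose, Matrix.mul_assoc]
  have htrace (g f : Fin n → ℝ) (X : Matrix (Fin n) (Fin n) ℂ) :
      ((U * realDiag g * Uᴴ) * (X * realDiag f * Xᴴ)).trace =
        ((∑ i, ∑ k, g i * f k * Complex.normSq ((Uᴴ * X) i k) : ℝ) : ℂ) := by
    rw [← trace_realDiag_mul_conj, Matrix.mul_assoc, Matrix.mul_assoc, trace_mul_comm]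
    simp only [conjTranspose_mul, conjTranspose_conjTranspose, Matrix.mul_assoc]
  have hlhs : (A * geomMean A B t).trace =
      ((∑ i, ∑ k, a i ^ 2 * c k ^ t * Complex.normSq ((Uᴴ * W) i k) : ℝ) : ℂ) := by
    rw [← htrace, geomMean, ← Matrix.mul_assoc, trace_mul_comm, ← Matrix.mul_assoc,
      ← Matrix.mul_assoc, hCp, hAp, hAeq, conj_realDiag_mul_conj hU, conj_realDiag_mul_conj hU]
    congr 5
    ext i
    rw [hsqrt, mul_right_comm, Real.mul_self_sqrt (ha i).le, sq]
  rw [hlhs, hAp, hBp, htrace, Complex.real_le_real]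
  exact sum_rpow_le hUV hUW ha hb hc hrel ht
end

section
/- Let A and B be n×n positive definite complex matrices and t ∈ [0,1]. Then Tr((A♯_t B)(A♯_{1−t} B)) ≤ Tr(AB). -/
open Matrix ComplexOrder

/-- Real powers of a positive definite matrix multiply by adding exponents. -/
theorem mpow_mul_mpow {n : ℕ} {A : Matrix (Fin n) (Fin n) ℂ} (hA : A.PosDef) (r s : ℝ) :
    mpow A r * mpow A s = mpow A (r + s) := by
  have hU : (star hA.1.eigenvectorUnitary : Matrix (Fin n) (Fin n) ℂ) *
      (hA.1.eigenvectorUnitary : Matrix (Fin n) (Fin n) ℂ) = 1 :=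
    Unitary.coe_star_mul_self _
  have hD : Matrix.diagonal (fun i => ((hA.1.eigenvalues i ^ r : ℝ) : ℂ)) *
      Matrix.diagonal (fun i => ((hA.1.eigenvalues i ^ s : ℝ) : ℂ)) =
      Matrix.diagonal (fun i => ((hA.1.eigenvalues i ^ (r + s) : ℝ) : ℂ)) := by
    rw [Matrix.diagonal_mul_diagonal]
    congr 1
    ext i
    rw [Real.rpow_add (hA.eigenvalues_pos i), Complex.ofReal_mul]
  simp only [mpow, dif_pos hA.1, ← hD, Matrix.mul_assoc]
  congr 2
  rw [← Matrix.mul_assoc _ _ (Matrix.diagonal _ * _), hU, Matrix.one_mul]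

theorem mpow_zero {n : ℕ} {A : Matrix (Fin n) (Fin n) ℂ} (hA : A.IsHermitian) :
    mpow A 0 = 1 := by
  simp [mpow, dif_pos hA]

theorem mpow_one {n : ℕ} {A : Matrix (Fin n) (Fin n) ℂ} (hA : A.IsHermitian) :
    mpow A 1 = A := by
  conv_rhs => rw [hA.spectral_theorem]
  simp [mpow, dif_pos hA, Unitary.conjStarAlgAut_apply, Function.comp_def]

theorem isHermitian_mpow {n : ℕ} {A : Matrix (Fin n) (Fin n) ℂ} (hA : A.IsHermitian) (r : ℝ) :
    (mpow A r).IsHermitian := by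
  rw [mpow, dif_pos hA]
  refine Matrix.isHermitian_mul_mul_conjTranspose _ ?_
  exact Matrix.isHermitian_diagonal_of_self_adjoint _ (by ext i; simp)

theorem trace_mul_diagonal_mul_mul_diagonal {n : ℕ} {M : Matrix (Fin n) (Fin n) ℂ}
    (hM : M.IsHermitian) (d e : Fin n → ℝ) :
    (M * Matrix.diagonal (fun i => (d i : ℂ)) * (M * Matrix.diagonal (fun i => (e i : ℂ)))).trace =
      ((∑ i, ∑ j, Complex.normSq (M i j) * (d j * e i) : ℝ) : ℂ) := by
  rw [Matrix.trace]
  push_cast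
  refine Finset.sum_congr rfl fun i _ => ?_
  rw [Matrix.diag_apply, Matrix.mul_apply]
  refine Finset.sum_congr rfl fun j _ => ?_
  rw [Matrix.mul_diagonal, Matrix.mul_diagonal, ← hM.apply j i, Complex.normSq_eq_conj_mul_self,
    Complex.star_def]
  ring

/-- Conjugating by the eigenvectors of `C` turns `Tr(A Cʳ A Cˢ)` into a weighted double sum. -/
theorem trace_mul_mpow_mul_mul_mpow {n : ℕ} {A C : Matrix (Fin n) (Fin n) ℂ}
    (hA : A.IsHermitian) (hC : C.IsHermitian) :
    ∃ w : Fin n → Fin n → ℝ, (∀ i j, 0 ≤ w i j) ∧ (∀ i j, w i j = w j i) ∧ ∀ r s : ℝ,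
      (A * mpow C r * (A * mpow C s)).trace =
        ((∑ i, ∑ j, w i j * (hC.eigenvalues j ^ r * hC.eigenvalues i ^ s) : ℝ) : ℂ) := by
  set U := (hC.eigenvectorUnitary : Matrix (Fin n) (Fin n) ℂ) with hU
  have hM : (star U * A * U).IsHermitian := Matrix.isHermitian_conjTranspose_mul_mul _ hA
  refine ⟨fun i j => Complex.normSq ((star U * A * U) i j), fun i j => Complex.normSq_nonneg _,
    fun i j => ?_, fun r s => ?_⟩
  · simp only
    rw [← hM.apply i j, Complex.star_def, Complex.normSq_conj]
  · rw [← trace_mul_diagonal_mul_mul_diagonal hM]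
    simp only [mpow, dif_pos hC, ← hU]
    simp only [← Matrix.mul_assoc]
    rw [Matrix.trace_mul_comm]
    simp only [Matrix.mul_assoc]

/-- `Tr(A Cᵗ A C¹⁻ᵗ) ≤ Tr(A² C)`, by the weighted AM-GM inequality in an eigenbasis of `C`. -/
theorem trace_mul_mpow_mul_mul_mpow_le {n : ℕ} {A C : Matrix (Fin n) (Fin n) ℂ}
    (hA : A.IsHermitian) (hC : C.PosSemidef) {t : ℝ} (ht : t ∈ Set.Icc (0 : ℝ) 1) :
    (A * mpow C t * (A * mpow C (1 - t))).trace ≤ (A * (A * C)).trace := by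
  obtain ⟨w, hw, hsymm, h⟩ := trace_mul_mpow_mul_mul_mpow hA hC.1
  have h01 := h 0 1
  rw [mpow_zero hC.1, mpow_one hC.1, Matrix.mul_one] at h01
  rw [h, h01, Complex.real_le_real]
  simp only [Real.rpow_zero, Real.rpow_one, one_mul]
  set c := hC.1.eigenvalues
  have hswap : ∑ i, ∑ j, w i j * c j = ∑ i, ∑ j, w i j * c i := by
    rw [Finset.sum_comm]
    exact Finset.sum_congr rfl fun i _ => Finset.sum_congr rfl fun j _ => by rw [hsymm]
  calc ∑ i, ∑ j, w i j * (c j ^ t * c i ^ (1 - t))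
      ≤ ∑ i, ∑ j, w i j * (t * c j + (1 - t) * c i) := by
        gcongr with i _ j _
        · exact hw i j
        · exact Real.geom_mean_le_arith_mean2_weighted ht.1 (by linarith [ht.2])
            (hC.eigenvalues_nonneg j) (hC.eigenvalues_nonneg i) (by ring)
    _ = t * ∑ i, ∑ j, w i j * c j + (1 - t) * ∑ i, ∑ j, w i j * c i := by
        simp only [Finset.mul_sum, ← Finset.sum_add_distrib]
        exact Finset.sum_congr rfl fun i _ => Finset.sum_congr rfl fun j _ => by ring
    _ = ∑ i, ∑ j, w i j * c i := by rw [hswap]; ring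

/-- `Tr((A♯ₜB)(A♯₁₋ₜB)) ≤ Tr(AB)`. -/
theorem stmt_7 {n : ℕ} (A B : Matrix (Fin n) (Fin n) ℂ)
    (hA : A.PosDef) (hB : B.PosDef) (t : ℝ) (ht : t ∈ Set.Icc (0:ℝ) 1) :
    (geomMean A B t * geomMean A B (1 - t)).trace ≤ (A * B).trace := by
  set S := mpow A (1 / 2) with hS
  set R := mpow A (-(1 / 2)) with hR
  set C := R * B * R with hC
  have hSS : S * S = A := by
    rw [hS, mpow_mul_mpow hA, add_halves, mpow_one hA.1]
  have hSR : S * R = 1 := by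
    rw [hS, hR, mpow_mul_mpow hA, add_neg_cancel, mpow_zero hA.1]
  have hRS : R * S = 1 := by
    rw [hS, hR, mpow_mul_mpow hA, neg_add_cancel, mpow_zero hA.1]
  have hCpos : C.PosSemidef := by
    have h := hB.posSemidef.conjTranspose_mul_mul_same R
    rwa [(isHermitian_mpow hA.1 _).eq] at h
  have hBC : B = S * C * S := by
    calc B = (S * R) * B * (R * S) := by rw [hSR, hRS, Matrix.one_mul, Matrix.mul_one]
      _ = S * C * S := by simp only [hC, Matrix.mul_assoc]
  have hl : (geomMean A B t * geomMean A B (1 - t)).trace =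
      (A * mpow C t * (A * mpow C (1 - t))).trace := by
    calc (geomMean A B t * geomMean A B (1 - t)).trace
        = (S * (mpow C t * (S * S) * mpow C (1 - t) * S)).trace := by
          simp only [geomMean, ← hS, ← hR, ← hC, Matrix.mul_assoc]
      _ = (mpow C t * A * mpow C (1 - t) * (S * S)).trace := by
          rw [Matrix.trace_mul_comm, hSS, Matrix.mul_assoc _ S S, hSS]
      _ = (A * mpow C t * (A * mpow C (1 - t))).trace := by
          rw [hSS, Matrix.trace_mul_comm]
          simp only [Matrix.mul_assoc]
  have hr : (A * B).trace = (A * (A * C)).trace := by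
    calc (A * B).trace = (S * S * (S * C) * S).trace := by
          rw [hSS, Matrix.mul_assoc, ← hBC]
      _ = (S * S * (S * S * C)).trace := by
          rw [Matrix.trace_mul_comm]
          simp only [Matrix.mul_assoc]
      _ = (A * (A * C)).trace := by rw [hSS]
  rw [hl, hr]
  exact trace_mul_mpow_mul_mul_mpow_le hA.1 hCpos ht
end
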